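/- Let I be a finite index set, let B = (b_ij) be a skew-symmetric matrix with integer entries indexed by I × I (b_ji = −b_ij for all i, j), let k ∈ I, and let S = (s_ij) be the matrix defined by s_ij = −δ_ij + (|b_ij| − b_ij)/2 if i = k and s_ij = δ_ij otherwise. Then the Fomin–Zelevinsky mutation of B in direction k is given by conjugation: μ_k(B) = Sᵗ B S. -/

import Mathlib

open Matrix

/-- The Fomin–Zelevinsky mutation of an integer matrix `B` indexed by a finite set `I`
in the direction `k ∈ I` : the entry `b'_ij` is `-b_ij` if `i = k` or `j = k`, and
`b_ij + (|b_ik| * b_kj + b_ik * |b_kj|) / 2` otherwise (the division is exact since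
`|b_ik| * b_kj + b_ik * |b_kj|` is always even). -/
def fzMutation {I : Type*} [DecidableEq I] (B : Matrix I I ℤ) (k : I) : Matrix I I ℤ :=
  Matrix.of fun i j =>
    if i = k ∨ j = k then -B i j
    else B i j + (|B i k| * B k j + B i k * |B k j|) / 2

/-- The matrix `S = (s_ij)` associated with an integer matrix `B` and an index `k`,
defined by `s_ij = -δ_ij + (|b_ij| - b_ij)/2` if `i = k` and `s_ij = δ_ij` otherwise. -/
def fzS {I : Type*} [DecidableEq I] (B : Matrix I I ℤ) (k : I) : Matrix I I ℤ :=
  Matrix.of fun i j =>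
    if i = k then -(if i = j then (1 : ℤ) else 0) + (|B i j| - B i j) / 2
    else if i = j then 1 else 0

theorem fzS_apply_aux {I : Type*} [DecidableEq I] (B : Matrix I I ℤ) (k : I)
    (l j : I) : fzS B k l j = (if j = k then -1 else 1) * (if l = j then 1 else 0)
      + (if l = k then (|B k j| - B k j) / 2 else 0) := by
  unfold fzS
  simp only [Matrix.of_apply]
  by_cases h1 : l = k
  · subst h1
    by_cases h2 : l = j
    · subst h2; simp
    · simp [h2]
  · by_cases h2 : l = j
    · subst h2; simp [h1]
    · simp [h1, h2]

theorem fz_arith_aux (x y : ℤ) :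
    (|x| * y + x * |y|) / 2 = x * ((|y| - y) / 2) + ((|x| + x) / 2) * y := by
  have hy : 2 * ((|y| - y) / 2) = |y| - y := by
    rcases abs_cases y with h | h <;> omega
  have hx : 2 * ((|x| + x) / 2) = |x| + x := by
    rcases abs_cases x with h | h <;> omega
  apply Int.ediv_eq_of_eq_mul_right (by norm_num)
  linear_combination (-x) * hy - y * hx

/-- If `B` is skew-symmetric, the Fomin–Zelevinsky mutation of `B` in direction `k`
is given by conjugation: `μ_k(B) = Sᵗ * B * S`. -/
theorem fzMutation_eq_conj {I : Type*} [Fintype I] [DecidableEq I]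
    (B : Matrix I I ℤ) (k : I) (hB : Bᵀ = -B) :
    fzMutation B k = (fzS B k)ᵀ * B * fzS B k := by
  have hs : ∀ i j, B j i = -B i j := fun i j => by
    have := congrFun (congrFun hB i) j
    simpa using this
  have h0 : B k k = 0 := by have := hs k k; omega
  ext i j
  have key : ((fzS B k)ᵀ * B * fzS B k) i j =
      (if i = k then -1 else 1) * (if j = k then -1 else 1) * B i j
      + (if i = k then -1 else 1) * B i k * ((|B k j| - B k j) / 2)
      + ((|B k i| - B k i) / 2) * (if j = k then -1 else 1) * B k j := by
    have h1 : ∀ l, ((fzS B k)ᵀ * B) i l = (if i = k then -1 else 1) * B i l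
        + ((|B k i| - B k i) / 2) * B k l := by
      intro l
      simp only [Matrix.mul_apply, Matrix.transpose_apply, fzS_apply_aux, add_mul,
        Finset.sum_add_distrib, mul_assoc, ite_mul, one_mul, zero_mul,
        Finset.sum_ite_eq', Finset.mem_univ, if_true]
      split_ifs <;> simp
    rw [Matrix.mul_apply]
    simp only [h1, fzS_apply_aux, mul_add, Finset.sum_add_distrib]
    simp only [mul_left_comm _ (if j = k then (-1 : ℤ) else 1), ← Finset.mul_sum]
    simp only [mul_ite, mul_one, mul_zero, Finset.sum_ite_eq', Finset.mem_univ, if_true,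
      add_mul]
    split_ifs <;> simp [h0] <;> ring
  rw [key]
  unfold fzMutation
  simp only [Matrix.of_apply]
  by_cases hi : i = k
  · subst hi
    by_cases hj : j = i
    · subst hj; simp [h0]
    · simp [hj, h0]
  · by_cases hj : j = k
    · subst hj; simp [hi, h0]
    · simp only [hi, hj, or_self, if_false]
      rw [fz_arith_aux, hs i k, abs_neg, sub_neg_eq_add]
      ring
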